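/- The Fisher information metric of the 2×2 Wishart model W₂(m, Σ) at a point Σ is ⟨A,B⟩_Σ = (m/2) tr(Σ^{-1} A Σ^{-1} B) for symmetric tangent matrices A, B, and in the parameterization Σ = e^λ R_θ diag(e^ρ, e^{−ρ}) R_θ^T (with R_θ rotation by θ/2) this metric equals m(dλ² + dρ² + sinh²ρ dθ²). -/

import Mathlib

open Real Matrix MeasureTheory

/-- Partial derivative in the `i`-th coordinate direction on `Fin d → ℝ`. -/
noncomputable def pderiv' {d : ℕ} (i : Fin d) (f : (Fin d → ℝ) → ℝ) (x : Fin d → ℝ) : ℝ :=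
  fderiv ℝ f x (Pi.single i 1)

/-- Rotation matrix by angle `α`. -/
noncomputable def rotM (α : ℝ) : Matrix (Fin 2) (Fin 2) ℝ :=
  !![Real.cos α, -Real.sin α; Real.sin α, Real.cos α]

/-- The parameterization `Σ(λ,ρ,θ) = e^λ R_{θ/2} diag(e^ρ, e^{−ρ}) R_{θ/2}^T`,
with `(λ,ρ,θ) = (x 0, x 1, x 2)`. -/
noncomputable def sigmaP (x : Fin 3 → ℝ) : Matrix (Fin 2) (Fin 2) ℝ :=
  Real.exp (x 0) •
    (rotM (x 2 / 2) * Matrix.diagonal ![Real.exp (x 1), Real.exp (-x 1)] * (rotM (x 2 / 2))ᵀ)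

/-- Coordinate partial derivative of the matrix-valued map `sigmaP`. -/
noncomputable def dSigma (a : Fin 3) (x : Fin 3 → ℝ) : Matrix (Fin 2) (Fin 2) ℝ :=
  Matrix.of fun i j => pderiv' a (fun y => sigmaP y i j) x

/-- The symmetric matrix with independent entries `(v 0, v 1, v 2) = (X₁₁, X₁₂, X₂₂)`. -/
noncomputable def symOf (v : Fin 3 → ℝ) : Matrix (Fin 2) (Fin 2) ℝ := !![v 0, v 1; v 1, v 2]

open Classical in
/-- The `W₂(m, S)` Wishart density on the coordinates `(X₁₁, X₁₂, X₂₂)`,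
with `Γ₂(m/2) = π^{1/2} Γ(m/2) Γ((m−1)/2)`. -/
noncomputable def wishartDens (m : ℝ) (S : Matrix (Fin 2) (Fin 2) ℝ) (v : Fin 3 → ℝ) : ℝ :=
  if (symOf v).PosDef then
    ((2 : ℝ) ^ m * (Real.sqrt π * Real.Gamma (m / 2) * Real.Gamma ((m - 1) / 2)) *
        S.det ^ (m / 2))⁻¹ *
      (symOf v).det ^ ((m - 3) / 2) * Real.exp (-(S⁻¹ * symOf v).trace / 2)
  else 0

theorem lintegral_rpow_mul_exp_neg_mul_Ioi {p r : ℝ} (hp : 0 < p) (hr : 0 < r) :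
    ∫⁻ t in Set.Ioi (0 : ℝ), ENNReal.ofReal (t ^ (p - 1) * Real.exp (-(r * t))) =
      ENNReal.ofReal ((1 / r) ^ p * Real.Gamma p) := by
  rw [← Real.integral_rpow_mul_exp_neg_mul_Ioi hp hr]
  refine (ofReal_integral_eq_lintegral_ofReal (.of_integral_ne_zero ?_) ?_).symm
  · rw [Real.integral_rpow_mul_exp_neg_mul_Ioi hp hr]
    have := Real.Gamma_pos_of_pos hp
    positivity
  · filter_upwards [ae_restrict_mem measurableSet_Ioi] with t ht
    have : (0 : ℝ) < t := ht
    positivity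

theorem lintegral_exp_neg_quadratic {k : ℝ} (hk : 0 < k) (b : ℝ) :
    ∫⁻ y : ℝ, ENNReal.ofReal (Real.exp (-(k * y ^ 2) - b * y)) =
      ENNReal.ofReal (√(π / k) * Real.exp (b ^ 2 / (4 * k))) := by
  have h : ∀ y : ℝ, ENNReal.ofReal (Real.exp (-(k * y ^ 2) - b * y)) =
      ENNReal.ofReal (Real.exp (-k * (y + b / (2 * k)) ^ 2)) *
        ENNReal.ofReal (Real.exp (b ^ 2 / (4 * k))) := fun y ↦ by
    rw [← ENNReal.ofReal_mul (by positivity), ← Real.exp_add]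
    congr 2
    field_simp
    ring
  simp_rw [h]
  rw [lintegral_mul_const _ (by fun_prop),
    lintegral_add_right_eq_self (fun y ↦ ENNReal.ofReal (Real.exp (-k * y ^ 2))),
    ENNReal.ofReal_mul (by positivity), ← integral_gaussian k]
  congr 1
  exact (ofReal_integral_eq_lintegral_ofReal (integrable_exp_neg_mul_sq hk)
    (.of_forall fun y ↦ (Real.exp_pos _).le)).symm

theorem lintegral_fin_three {f : (Fin 3 → ℝ) → ENNReal} (hf : Measurable f) :
    ∫⁻ v, f v = ∫⁻ x : ℝ, ∫⁻ y : ℝ, ∫⁻ z : ℝ, f ![x, y, z] := by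
  have hm : Measurable fun p : ℝ × ℝ × ℝ ↦ f ![p.1, p.2.1, p.2.2] :=
    hf.comp (by
      refine measurable_pi_lambda _ fun i ↦ ?_
      fin_cases i <;> simp <;> fun_prop)
  have e₂ := (volume_preserving_finTwoArrow ℝ).symm
  have e₃ := (volume_preserving_piFinSuccAbove (fun _ : Fin 3 ↦ ℝ) 0).symm
  rw [← e₃.lintegral_comp hf, Measure.volume_eq_prod, lintegral_prod _ (by fun_prop)]
  congr 1 with x
  rw [← e₂.lintegral_comp (by fun_prop), Measure.volume_eq_prod, lintegral_prod _ (by fun_prop)]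
  congr 1 with y
  congr 1 with z
  congr 1
  ext i
  fin_cases i <;> rfl

theorem posDef_fin_two_iff {a b c : ℝ} :
    (!![a, b; b, c] : Matrix (Fin 2) (Fin 2) ℝ).PosDef ↔ 0 < a ∧ 0 < a * c - b ^ 2 := by
  constructor
  · intro h
    have h₁ := h.diag_pos (i := 0)
    have h₂ := h.det_pos
    simp only [Matrix.det_fin_two_of] at h₂
    exact ⟨h₁, by nlinarith⟩
  · rintro ⟨ha, hd⟩
    refine .of_dotProduct_mulVec_pos (by ext i j; fin_cases i <;> fin_cases j <;> rfl) ?_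
    intro x hx
    have key : a * (star x ⬝ᵥ (!![a, b; b, c] *ᵥ x)) =
        (a * x 0 + b * x 1) ^ 2 + (a * c - b ^ 2) * x 1 ^ 2 := by
      simp [Matrix.mulVec, dotProduct, Fin.sum_univ_two]
      ring
    refine pos_of_mul_pos_right (a := a) ?_ ha.le
    rw [key]
    rcases eq_or_ne (x 1) 0 with h₁ | h₁
    · have h₀ : x 0 ≠ 0 := fun h₀ ↦ hx (by ext i; fin_cases i <;> simpa)
      simp [h₁]
      positivity
    · positivity

/-- The unnormalised Wishart density with parameter matrix `!![a, b; b, c]`. -/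
noncomputable def wishartKernel (m a b c : ℝ) (v : Fin 3 → ℝ) : ℝ :=
  {w : Fin 3 → ℝ | 0 < w 0 ∧ 0 < w 0 * w 2 - w 1 ^ 2}.indicator
    (fun w ↦ (w 0 * w 2 - w 1 ^ 2) ^ ((m - 3) / 2) *
      Real.exp (-(a * w 0 + 2 * b * w 1 + c * w 2) / 2)) v

theorem measurable_wishartKernel (m a b c : ℝ) : Measurable (wishartKernel m a b c) := by
  refine Measurable.indicator (by fun_prop) ?_
  exact (measurableSet_lt (f := fun _ : Fin 3 → ℝ ↦ (0 : ℝ)) (g := fun w ↦ w 0) (by fun_prop)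
    (by fun_prop)).inter (measurableSet_lt (f := fun _ : Fin 3 → ℝ ↦ (0 : ℝ))
      (g := fun w ↦ w 0 * w 2 - w 1 ^ 2) (by fun_prop) (by fun_prop))

theorem wishartKernel_nonneg (m a b c : ℝ) (v : Fin 3 → ℝ) : 0 ≤ wishartKernel m a b c v := by
  refine Set.indicator_nonneg (fun w hw ↦ ?_) v
  have := hw.2
  positivity

theorem lintegral_wishartKernel_inner {m a b c x : ℝ} (hm : 1 < m) (hc : 0 < c) (hx : 0 < x)
    (y : ℝ) :
    ∫⁻ z : ℝ, ENNReal.ofReal (wishartKernel m a b c ![x, y, z]) =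
      ENNReal.ofReal (x ^ ((m - 3) / 2) * (2 / c) ^ ((m - 1) / 2) * Real.Gamma ((m - 1) / 2) *
        Real.exp (-(a * x) / 2)) *
        ENNReal.ofReal (Real.exp (-(c / (2 * x) * y ^ 2) - b * y)) := by
  have hΓ := Real.Gamma_pos_of_pos (show 0 < (m - 1) / 2 by linarith)
  set K := x ^ ((m - 3) / 2) * Real.exp (-(a * x) / 2) *
    Real.exp (-(c / (2 * x) * y ^ 2) - b * y) with hK
  set g : ℝ → ENNReal := (Set.Ioi 0).indicator fun w ↦
    ENNReal.ofReal K * ENNReal.ofReal (w ^ ((m - 1) / 2 - 1) * Real.exp (-(c / 2 * w))) with hg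
  have hshift : ∀ z, ENNReal.ofReal (wishartKernel m a b c ![x, y, z]) =
      g (z + -(y ^ 2 / x)) := by
    intro z
    have hz : x * z - y ^ 2 = x * (z + -(y ^ 2 / x)) := by field_simp; ring
    by_cases hw : 0 < z + -(y ^ 2 / x)
    · rw [hg, Set.indicator_of_mem (by exact hw), wishartKernel,
        Set.indicator_of_mem (by simpa only [Set.mem_ofPred_eq, Matrix.cons_val, hz] using ⟨hx, mul_pos hx hw⟩), ← ENNReal.ofReal_mul (by positivity)]
      simp only [Matrix.cons_val]
      rw [hz, Real.mul_rpow hx.le hw.le, show (m - 1) / 2 - 1 = (m - 3) / 2 by ring, hK]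
      have hexp : Real.exp (-(a * x + 2 * b * y + c * z) / 2) = Real.exp (-(a * x) / 2) *
          Real.exp (-(c / (2 * x) * y ^ 2) - b * y) * Real.exp (-(c / 2 * (z + -(y ^ 2 / x)))) := by
        rw [← Real.exp_add, ← Real.exp_add]
        congr 1
        field_simp
        ring
      rw [hexp]
      congr 1
      ring
    · rw [hg, Set.indicator_of_notMem (by exact hw), wishartKernel,
        Set.indicator_of_notMem, ENNReal.ofReal_zero]
      rintro ⟨-, h⟩
      simp only [Matrix.cons_val] at h
      rw [hz] at h
      exact hw (pos_of_mul_pos_right h hx.le)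
  simp_rw [hshift]
  rw [lintegral_add_right_eq_self, hg, lintegral_indicator measurableSet_Ioi,
    lintegral_const_mul _ (by fun_prop),
    lintegral_rpow_mul_exp_neg_mul_Ioi (by linarith) (by positivity),
    ← ENNReal.ofReal_mul (by positivity), ← ENNReal.ofReal_mul (by positivity), hK]
  congr 1
  rw [show 1 / (c / 2) = 2 / c by field_simp]
  ring

theorem lintegral_wishartKernel {m a b c : ℝ} (hm : 1 < m) (ha : 0 < a)
    (hd : 0 < a * c - b ^ 2) :
    ∫⁻ v, ENNReal.ofReal (wishartKernel m a b c v) =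
      ENNReal.ofReal ((2 : ℝ) ^ m * (√π * Real.Gamma (m / 2) * Real.Gamma ((m - 1) / 2)) *
        (a * c - b ^ 2) ^ (-(m / 2))) := by
  have hc : 0 < c := pos_of_mul_pos_right (by nlinarith [sq_nonneg b]) ha.le
  have hΓ := Real.Gamma_pos_of_pos (show 0 < (m - 1) / 2 by linarith)
  have hΓ' := Real.Gamma_pos_of_pos (show 0 < m / 2 by linarith)
  rw [lintegral_fin_three (measurable_wishartKernel m a b c).ennreal_ofReal]
  set K := (2 / c) ^ ((m - 1) / 2) * Real.Gamma ((m - 1) / 2) * √(2 * π / c) with hK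
  have hx : ∀ x, ∫⁻ y : ℝ, ∫⁻ z : ℝ, ENNReal.ofReal (wishartKernel m a b c ![x, y, z]) =
      (Set.Ioi 0).indicator (fun x ↦ ENNReal.ofReal K *
        ENNReal.ofReal (x ^ (m / 2 - 1) * Real.exp (-((a * c - b ^ 2) / (2 * c) * x)))) x := by
    intro x
    by_cases hx : 0 < x
    · rw [Set.indicator_of_mem (by exact hx)]
      simp_rw [lintegral_wishartKernel_inner hm hc hx]
      rw [lintegral_const_mul _ (by fun_prop), lintegral_exp_neg_quadratic (by positivity),
        ← ENNReal.ofReal_mul (by positivity), ← ENNReal.ofReal_mul (by positivity)]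
      have hsq : √(π / (c / (2 * x))) = √(2 * π / c) * x ^ (1 / 2 : ℝ) := by
        rw [← Real.sqrt_eq_rpow, ← Real.sqrt_mul (by positivity)]
        congr 1
        field_simp
      have hexp : Real.exp (-((a * c - b ^ 2) / (2 * c) * x)) =
          Real.exp (-(a * x) / 2) * Real.exp (b ^ 2 / (4 * (c / (2 * x)))) := by
        rw [← Real.exp_add]
        congr 1
        field_simp
        ring
      have hpow : x ^ (m / 2 - 1) = x ^ ((m - 3) / 2) * x ^ (1 / 2 : ℝ) := by
        rw [← Real.rpow_add hx]
        congr 1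
        ring
      rw [hsq, hexp, hpow, hK]
      congr 1
      ring
    · rw [Set.indicator_of_notMem (by exact hx)]
      simp [wishartKernel, hx]
  simp_rw [hx]
  rw [lintegral_indicator measurableSet_Ioi, lintegral_const_mul _ (by fun_prop),
    lintegral_rpow_mul_exp_neg_mul_Ioi (by linarith) (by positivity),
    ← ENNReal.ofReal_mul (by positivity), hK]
  congr 1
  have h₁ : √(2 * π / c) = √π * (2 / c) ^ (1 / 2 : ℝ) := by
    rw [← Real.sqrt_eq_rpow, ← Real.sqrt_mul (by positivity)]
    congr 1
    ring
  have h₂ : (2 / c) ^ ((m - 1) / 2) * (2 / c) ^ (1 / 2 : ℝ) = (2 / c) ^ (m / 2) := by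
    rw [← Real.rpow_add (by positivity)]
    congr 1
    ring
  have h₃ : (2 / c) ^ (m / 2) * (1 / ((a * c - b ^ 2) / (2 * c))) ^ (m / 2) =
      2 ^ m * (a * c - b ^ 2) ^ (-(m / 2)) := by
    rw [← Real.mul_rpow (by positivity) (by positivity), Real.rpow_neg hd.le,
      ← Real.inv_rpow hd.le,
      show 2 / c * (1 / ((a * c - b ^ 2) / (2 * c))) = 2 ^ (2 : ℝ) * (a * c - b ^ 2)⁻¹ by
        norm_num; field_simp; norm_num,
      Real.mul_rpow (by positivity) (by positivity), ← Real.rpow_mul (by norm_num)]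
    congr 2
    ring
  rw [h₁]
  linear_combination √π * Real.Gamma (m / 2) * Real.Gamma ((m - 1) / 2) *
    ((1 / ((a * c - b ^ 2) / (2 * c))) ^ (m / 2) * h₂ + h₃)

theorem integral_wishartKernel {m a b c : ℝ} (hm : 1 < m) (ha : 0 < a)
    (hd : 0 < a * c - b ^ 2) :
    ∫ v, wishartKernel m a b c v =
      (2 : ℝ) ^ m * (√π * Real.Gamma (m / 2) * Real.Gamma ((m - 1) / 2)) *
        (a * c - b ^ 2) ^ (-(m / 2)) := by
  have hΓ := Real.Gamma_pos_of_pos (show 0 < (m - 1) / 2 by linarith)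
  have hΓ' := Real.Gamma_pos_of_pos (show 0 < m / 2 by linarith)
  rw [integral_eq_lintegral_of_nonneg_ae (.of_forall (wishartKernel_nonneg m a b c))
    (measurable_wishartKernel m a b c).aestronglyMeasurable, lintegral_wishartKernel hm ha hd,
    ENNReal.toReal_ofReal (by positivity)]

theorem integrable_wishartKernel {m a b c : ℝ} (hm : 1 < m) (ha : 0 < a)
    (hd : 0 < a * c - b ^ 2) : Integrable (wishartKernel m a b c) := by
  have hΓ := Real.Gamma_pos_of_pos (show 0 < (m - 1) / 2 by linarith)
  have hΓ' := Real.Gamma_pos_of_pos (show 0 < m / 2 by linarith)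
  refine .of_integral_ne_zero ?_
  rw [integral_wishartKernel hm ha hd]
  positivity

theorem trace_inv_mul_fin_two {R : Type*} [Field R] (M N : Matrix (Fin 2) (Fin 2) R) :
    (M⁻¹ * N).trace = (M 1 1 * N 0 0 - M 0 1 * N 1 0 - M 1 0 * N 0 1 + M 0 0 * N 1 1) / M.det := by
  rw [Matrix.inv_def, Ring.inverse_eq_inv', Matrix.adjugate_fin_two]
  simp only [Matrix.smul_mul, Matrix.trace_smul, Matrix.trace_fin_two, Matrix.mul_apply,
    Fin.sum_univ_two, Matrix.of_apply, Matrix.cons_val, Matrix.cons_val', smul_eq_mul]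
  ring

/-- The derivative of `Σ ↦ log (wishartDens m Σ v)` at `S` in the direction `A`. -/
noncomputable def wishartScore (m : ℝ) (S A : Matrix (Fin 2) (Fin 2) ℝ) (v : Fin 3 → ℝ) : ℝ :=
  ((S⁻¹ * A * S⁻¹ * symOf v).trace - m * (S⁻¹ * A).trace) / 2

theorem det_add_smul_fin_two (S A : Matrix (Fin 2) (Fin 2) ℝ) (t : ℝ) :
    (S + t • A).det = (S 0 0 + t * A 0 0) * (S 1 1 + t * A 1 1) -
      (S 0 1 + t * A 0 1) * (S 1 0 + t * A 1 0) := by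
  simp [Matrix.det_fin_two]

theorem hasDerivAt_det_add_smul (S A : Matrix (Fin 2) (Fin 2) ℝ) :
    HasDerivAt (fun t : ℝ ↦ (S + t • A).det)
      (A 0 0 * S 1 1 + S 0 0 * A 1 1 - (A 0 1 * S 1 0 + S 0 1 * A 1 0)) 0 := by
  simp_rw [det_add_smul_fin_two]
  have h : ∀ i j, HasDerivAt (fun t : ℝ ↦ S i j + t * A i j) (A i j) 0 := fun i j ↦ by
    simpa using ((hasDerivAt_id (0 : ℝ)).mul_const (A i j)).const_add (S i j)
  simpa using ((h 0 0).fun_mul (h 1 1)).fun_sub ((h 0 1).fun_mul (h 1 0))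

theorem hasDerivAt_trace_inv_add_smul {S : Matrix (Fin 2) (Fin 2) ℝ} (hS : S.det ≠ 0)
    (A X : Matrix (Fin 2) (Fin 2) ℝ) :
    HasDerivAt (fun t : ℝ ↦ ((S + t • A)⁻¹ * X).trace) (-(S⁻¹ * A * S⁻¹ * X).trace) 0 := by
  simp_rw [trace_inv_mul_fin_two]
  have h : ∀ i j, HasDerivAt (fun t : ℝ ↦ (S + t • A) i j) (A i j) 0 := fun i j ↦ by
    simpa using ((hasDerivAt_id (0 : ℝ)).mul_const (A i j)).const_add (S i j)
  have hd := hasDerivAt_det_add_smul S A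
  have hn := ((((h 1 1).mul_const (X 0 0)).fun_sub ((h 0 1).mul_const (X 1 0))).fun_sub
    ((h 1 0).mul_const (X 0 1))).fun_add ((h 0 0).mul_const (X 1 1))
  refine (hn.fun_div hd (by simpa using hS)).congr_deriv ?_
  have e : S⁻¹ = S.det⁻¹ • !![S 1 1, -S 0 1; -S 1 0, S 0 0] := by
    rw [Matrix.inv_def, Ring.inverse_eq_inv', Matrix.adjugate_fin_two]
  rw [e]
  simp only [zero_smul, add_zero, Matrix.smul_mul, Matrix.mul_smul, Matrix.trace_smul,
    smul_eq_mul]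
  field_simp
  simp only [Matrix.trace_fin_two, Matrix.mul_apply, Fin.sum_univ_two, Matrix.of_apply,
    Matrix.cons_val, Matrix.cons_val', Matrix.det_fin_two]
  ring

theorem hasDerivAt_log_wishartDens {m : ℝ} (hm : 1 < m) {S : Matrix (Fin 2) (Fin 2) ℝ}
    (hS : 0 < S.det) (A : Matrix (Fin 2) (Fin 2) ℝ) {v : Fin 3 → ℝ} (hv : (symOf v).PosDef) :
    HasDerivAt (fun t : ℝ ↦ Real.log (wishartDens m (S + t • A) v)) (wishartScore m S A v) 0 := by
  have hΓ := Real.Gamma_pos_of_pos (show 0 < (m - 1) / 2 by linarith)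
  have hΓ' := Real.Gamma_pos_of_pos (show 0 < m / 2 by linarith)
  have hX := hv.det_pos
  have hd := hasDerivAt_det_add_smul S A
  have hpos : ∀ᶠ t in nhds (0 : ℝ), 0 < (S + t • A).det :=
    hd.continuousAt.eventually (lt_mem_nhds (by simpa using hS))
  have hlog := ((hd.log (by simpa using hS.ne')).const_mul (m / 2)).const_sub
    (Real.log ((symOf v).det ^ ((m - 3) / 2)) -
      Real.log ((2 : ℝ) ^ m * (√π * Real.Gamma (m / 2) * Real.Gamma ((m - 1) / 2))))
  refine (((hlog.fun_sub ((hasDerivAt_trace_inv_add_smul hS.ne' A (symOf v)).div_const 2))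
    ).congr_of_eventuallyEq ?_).congr_deriv ?_
  · filter_upwards [hpos] with t ht
    rw [wishartDens, if_pos hv, Real.log_mul (by positivity) (by positivity),
      Real.log_mul (by positivity) (by positivity), Real.log_exp, Real.log_inv,
      Real.log_mul (by positivity) (by positivity), Real.log_rpow ht]
    ring
  · rw [wishartScore, trace_inv_mul_fin_two S A]
    simp only [zero_smul, add_zero]
    field_simp
    ring

theorem wishartScore_add (m : ℝ) (S A B : Matrix (Fin 2) (Fin 2) ℝ) (v : Fin 3 → ℝ) :
    wishartScore m S (A + B) v = wishartScore m S A v + wishartScore m S B v := by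
  simp only [wishartScore, Matrix.mul_add, Matrix.add_mul, Matrix.trace_add]
  ring

theorem wishartScore_sub (m : ℝ) (S A B : Matrix (Fin 2) (Fin 2) ℝ) (v : Fin 3 → ℝ) :
    wishartScore m S (A - B) v = wishartScore m S A v - wishartScore m S B v := by
  simp only [wishartScore, Matrix.mul_sub, Matrix.sub_mul, Matrix.trace_sub]
  ring

theorem wishartDens_eq_wishartKernel (m : ℝ) {S : Matrix (Fin 2) (Fin 2) ℝ} (hS : S.IsSymm)
    (v : Fin 3 → ℝ) :
    wishartDens m S v = ((2 : ℝ) ^ m * (√π * Real.Gamma (m / 2) * Real.Gamma ((m - 1) / 2)) *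
      S.det ^ (m / 2))⁻¹ * wishartKernel m (S⁻¹ 0 0) (S⁻¹ 0 1) (S⁻¹ 1 1) v := by
  have hT : S⁻¹ 1 0 = S⁻¹ 0 1 := by
    simpa [hS.eq] using congrFun₂ (Matrix.transpose_nonsing_inv S) 0 1
  have hmem : v ∈ {w : Fin 3 → ℝ | 0 < w 0 ∧ 0 < w 0 * w 2 - w 1 ^ 2} ↔ (symOf v).PosDef :=
    posDef_fin_two_iff.symm
  by_cases hv : (symOf v).PosDef
  · rw [wishartDens, if_pos hv, wishartKernel, Set.indicator_of_mem (hmem.2 hv)]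
    have e₁ : (symOf v).det = v 0 * v 2 - v 1 ^ 2 := by
      simp [symOf, Matrix.det_fin_two]
      ring
    have e₂ : (S⁻¹ * symOf v).trace = S⁻¹ 0 0 * v 0 + 2 * S⁻¹ 0 1 * v 1 + S⁻¹ 1 1 * v 2 := by
      simp [symOf, Matrix.trace_fin_two, Matrix.mul_apply, Fin.sum_univ_two, hT]
      ring
    rw [e₁, e₂]
    ring
  · rw [wishartDens, if_neg hv, wishartKernel,
      Set.indicator_of_notMem (hmem.not.2 hv), mul_zero]

theorem exp_mul_wishartKernel (m s t a b c a' b' c' : ℝ) (v : Fin 3 → ℝ) :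
    Real.exp (t * ((a' * v 0 + 2 * b' * v 1 + c' * v 2 - s) / 2)) * wishartKernel m a b c v =
      Real.exp (-(t * s) / 2) * wishartKernel m (a - t * a') (b - t * b') (c - t * c') v := by
  simp only [wishartKernel]
  by_cases hv : v ∈ {w : Fin 3 → ℝ | 0 < w 0 ∧ 0 < w 0 * w 2 - w 1 ^ 2}
  · rw [Set.indicator_of_mem hv, Set.indicator_of_mem hv, mul_left_comm,
      mul_left_comm (Real.exp (-(t * s) / 2)), ← Real.exp_add, ← Real.exp_add]
    congr 2
    ring
  · rw [Set.indicator_of_notMem hv, Set.indicator_of_notMem hv, mul_zero, mul_zero]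

theorem deriv_deriv_exp_mul_rpow (m τ δ : ℝ) :
    deriv (deriv fun t : ℝ ↦ Real.exp (-(t * (m * τ)) / 2) *
      (1 - t * τ + t ^ 2 * δ) ^ (-(m / 2))) 0 = m / 2 * (τ ^ 2 - 2 * δ) := by
  set q : ℝ → ℝ := fun t ↦ 1 - t * τ + t ^ 2 * δ with hq
  set G : ℝ → ℝ := fun t ↦ Real.exp (-(t * (m * τ)) / 2) * q t ^ (-(m / 2)) with hG
  have hq' : ∀ t, HasDerivAt q (-τ + 2 * t * δ) t := fun t ↦ by
    refine ((((hasDerivAt_id t).mul_const τ).const_sub 1).fun_add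
      (((hasDerivAt_id t).fun_pow 2).mul_const δ)).congr_deriv ?_
    simp
  have hpos : ∀ᶠ t in nhds (0 : ℝ), 0 < q t :=
    (hq' 0).continuousAt.eventually (lt_mem_nhds (by simp [hq]))
  have hG' : ∀ t, 0 < q t →
      HasDerivAt G (G t * (-(m / 2) * (τ + (-τ + 2 * t * δ) / q t))) t := fun t ht ↦ by
    have h₁ : HasDerivAt (fun t : ℝ ↦ Real.exp (-(t * (m * τ)) / 2))
        (Real.exp (-(t * (m * τ)) / 2) * (-(m * τ) / 2)) t := by
      simpa using ((((hasDerivAt_id t).mul_const (m * τ)).fun_neg).div_const 2).exp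
    refine (h₁.fun_mul ((hq' t).rpow_const (p := -(m / 2)) (.inl ht.ne'))).congr_deriv ?_
    rw [Real.rpow_sub_one ht.ne', hG]
    field_simp
    ring
  have hev : deriv G =ᶠ[nhds 0] fun t ↦ G t * (-(m / 2) * (τ + (-τ + 2 * t * δ) / q t)) :=
    hpos.mono fun t ht ↦ (hG' t ht).deriv
  have hq0 : q 0 = 1 := by simp [hq]
  have hG0 : G 0 = 1 := by simp [hG, hq0]
  have hlin : HasDerivAt (fun t : ℝ ↦ -τ + 2 * t * δ) (2 * δ) 0 := by
    simpa using (((hasDerivAt_id (0 : ℝ)).const_mul 2).mul_const δ).const_add (-τ)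
  rw [hev.deriv_eq]
  refine ((hG' 0 (by simp [hq0])).fun_mul
    (((hlin.fun_div (hq' 0) (by simp [hq0])).const_add τ).const_mul (-(m / 2)))).deriv.trans ?_
  rw [hG0, hq0]
  ring

theorem Matrix.PosDef.isSymm_of_real {n : Type*} {S : Matrix n n ℝ} (hS : S.PosDef) :
    S.IsSymm :=
  (Matrix.conjTranspose_eq_transpose_of_trivial S).symm.trans hS.isHermitian

theorem wishartDens_nonneg {m : ℝ} (hm : 1 < m) {S : Matrix (Fin 2) (Fin 2) ℝ} (hS : S.PosDef)
    (v : Fin 3 → ℝ) : 0 ≤ wishartDens m S v := by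
  have hΓ := Real.Gamma_pos_of_pos (show 0 < (m - 1) / 2 by linarith)
  have hΓ' := Real.Gamma_pos_of_pos (show 0 < m / 2 by linarith)
  have hd := hS.det_pos
  have hK := wishartKernel_nonneg m (S⁻¹ 0 0) (S⁻¹ 0 1) (S⁻¹ 1 1) v
  rw [wishartDens_eq_wishartKernel m hS.isSymm_of_real]
  positivity

theorem measurable_wishartDens (m : ℝ) {S : Matrix (Fin 2) (Fin 2) ℝ} (hS : S.IsSymm) :
    Measurable (wishartDens m S) := by
  rw [funext (wishartDens_eq_wishartKernel m hS)]
  exact (measurable_wishartKernel _ _ _ _).const_mul _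

/-- The Wishart distribution in the coordinates `(X₁₁, X₁₂, X₂₂)`. -/
noncomputable def wishartMeasure (m : ℝ) (S : Matrix (Fin 2) (Fin 2) ℝ) : Measure (Fin 3 → ℝ) :=
  volume.withDensity fun v ↦ ENNReal.ofReal (wishartDens m S v)

theorem integral_wishartMeasure {m : ℝ} (hm : 1 < m) {S : Matrix (Fin 2) (Fin 2) ℝ}
    (hS : S.PosDef) (f : (Fin 3 → ℝ) → ℝ) :
    ∫ v, f v ∂wishartMeasure m S = ∫ v, f v * wishartDens m S v := by
  rw [wishartMeasure, integral_withDensity_eq_integral_toReal_smul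
    (measurable_wishartDens m hS.isSymm_of_real).ennreal_ofReal
    (.of_forall fun _ ↦ ENNReal.ofReal_lt_top)]
  refine integral_congr_ae (.of_forall fun v ↦ ?_)
  simp only [ENNReal.toReal_ofReal (wishartDens_nonneg hm hS v), smul_eq_mul, mul_comm]

theorem integrable_wishartMeasure_iff {m : ℝ} (hm : 1 < m) {S : Matrix (Fin 2) (Fin 2) ℝ}
    (hS : S.PosDef) {f : (Fin 3 → ℝ) → ℝ} :
    Integrable f (wishartMeasure m S) ↔ Integrable fun v ↦ f v * wishartDens m S v := by
  rw [wishartMeasure, integrable_withDensity_iff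
    (measurable_wishartDens m hS.isSymm_of_real).ennreal_ofReal
    (.of_forall fun _ ↦ ENNReal.ofReal_lt_top)]
  simp only [ENNReal.toReal_ofReal (wishartDens_nonneg hm hS _)]

theorem exp_mul_wishartScore_mul_wishartDens (m : ℝ) {S A : Matrix (Fin 2) (Fin 2) ℝ}
    (hS : S.IsSymm) (hA : A.IsSymm) (t : ℝ) (v : Fin 3 → ℝ) :
    Real.exp (t * wishartScore m S A v) * wishartDens m S v =
      ((2 : ℝ) ^ m * (√π * Real.Gamma (m / 2) * Real.Gamma ((m - 1) / 2)) *
        S.det ^ (m / 2))⁻¹ * Real.exp (-(t * (m * (S⁻¹ * A).trace)) / 2) *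
        wishartKernel m (S⁻¹ 0 0 - t * (S⁻¹ * A * S⁻¹) 0 0) (S⁻¹ 0 1 - t * (S⁻¹ * A * S⁻¹) 0 1)
          (S⁻¹ 1 1 - t * (S⁻¹ * A * S⁻¹) 1 1) v := by
  have hT : (S⁻¹)ᵀ = S⁻¹ := by rw [Matrix.transpose_nonsing_inv, hS.eq]
  have hP : (S⁻¹ * A * S⁻¹) 1 0 = (S⁻¹ * A * S⁻¹) 0 1 := by
    conv_rhs => rw [← Matrix.transpose_apply (S⁻¹ * A * S⁻¹) 1 0, Matrix.transpose_mul,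
      Matrix.transpose_mul, hT, hA.eq, ← Matrix.mul_assoc]
  have hs : wishartScore m S A v = ((S⁻¹ * A * S⁻¹) 0 0 * v 0 + 2 * (S⁻¹ * A * S⁻¹) 0 1 * v 1 +
      (S⁻¹ * A * S⁻¹) 1 1 * v 2 - m * (S⁻¹ * A).trace) / 2 := by
    rw [wishartScore, Matrix.trace_fin_two (S⁻¹ * A * S⁻¹ * symOf v),
      Matrix.mul_apply (M := S⁻¹ * A * S⁻¹), Matrix.mul_apply (M := S⁻¹ * A * S⁻¹),
      Fin.sum_univ_two, Fin.sum_univ_two, hP]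
    simp only [symOf, Matrix.of_apply, Matrix.cons_val, Matrix.cons_val']
    ring
  rw [hs, wishartDens_eq_wishartKernel m hS, mul_left_comm, exp_mul_wishartKernel,
    ← mul_assoc]

theorem det_sub_smul_congr_fin_two {T A : Matrix (Fin 2) (Fin 2) ℝ} (hT : T.IsSymm)
    (hA : A.IsSymm) (t : ℝ) :
    (T 0 0 - t * (T * A * T) 0 0) * (T 1 1 - t * (T * A * T) 1 1) -
        (T 0 1 - t * (T * A * T) 0 1) ^ 2 =
      T.det * (1 - t * (T * A).trace + t ^ 2 * (T * A).det) := by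
  have h₁ : T 1 0 = T 0 1 := hT.apply 0 1
  have h₂ : A 1 0 = A 0 1 := hA.apply 0 1
  simp only [Matrix.det_fin_two, Matrix.trace_fin_two, Matrix.mul_apply, Fin.sum_univ_two, h₁, h₂]
  ring

theorem eventually_posDef_sub_smul {T A : Matrix (Fin 2) (Fin 2) ℝ} (hT : T.PosDef) :
    ∀ᶠ t : ℝ in nhds 0, 0 < T 0 0 - t * (T * A * T) 0 0 ∧
      0 < 1 - t * (T * A).trace + t ^ 2 * (T * A).det := by
  have h₁ : ContinuousAt (fun t : ℝ ↦ T 0 0 - t * (T * A * T) 0 0) 0 := by fun_prop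
  have h₂ : ContinuousAt (fun t : ℝ ↦ 1 - t * (T * A).trace + t ^ 2 * (T * A).det) 0 := by fun_prop
  exact (h₁.eventually (lt_mem_nhds (by simpa using hT.diag_pos))).and
    (h₂.eventually (lt_mem_nhds (by simp)))

theorem eventually_integrable_exp_wishartScore {m : ℝ} (hm : 1 < m)
    {S A : Matrix (Fin 2) (Fin 2) ℝ} (hS : S.PosDef) (hA : A.IsSymm) :
    ∀ᶠ t : ℝ in nhds 0,
      Integrable (fun v ↦ Real.exp (t * wishartScore m S A v)) (wishartMeasure m S) := by
  filter_upwards [eventually_posDef_sub_smul (A := A) hS.inv] with t ⟨h₁, h₂⟩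
  rw [integrable_wishartMeasure_iff hm hS]
  simp_rw [exp_mul_wishartScore_mul_wishartDens m hS.isSymm_of_real hA]
  refine (integrable_wishartKernel hm h₁ ?_).const_mul _
  rw [det_sub_smul_congr_fin_two hS.inv.isSymm_of_real hA]
  exact mul_pos hS.inv.det_pos h₂

theorem mgf_wishartScore {m : ℝ} (hm : 1 < m) {S A : Matrix (Fin 2) (Fin 2) ℝ} (hS : S.PosDef)
    (hA : A.IsSymm) :
    ProbabilityTheory.mgf (wishartScore m S A) (wishartMeasure m S) =ᶠ[nhds 0] fun t ↦
      Real.exp (-(t * (m * (S⁻¹ * A).trace)) / 2) *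
        (1 - t * (S⁻¹ * A).trace + t ^ 2 * (S⁻¹ * A).det) ^ (-(m / 2)) := by
  have hΓ := Real.Gamma_pos_of_pos (show 0 < (m - 1) / 2 by linarith)
  have hΓ' := Real.Gamma_pos_of_pos (show 0 < m / 2 by linarith)
  have hd := hS.det_pos
  filter_upwards [eventually_posDef_sub_smul (A := A) hS.inv] with t ⟨h₁, h₂⟩
  have hdet := det_sub_smul_congr_fin_two hS.inv.isSymm_of_real hA t
  rw [ProbabilityTheory.mgf, integral_wishartMeasure hm hS]
  simp_rw [exp_mul_wishartScore_mul_wishartDens m hS.isSymm_of_real hA]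
  rw [integral_const_mul, integral_wishartKernel hm h₁ (hdet ▸ mul_pos hS.inv.det_pos h₂), hdet,
    Real.mul_rpow hS.inv.det_pos.le h₂.le, Matrix.det_nonsing_inv, Ring.inverse_eq_inv',
    Real.inv_rpow hd.le, Real.rpow_neg hd.le]
  field_simp

theorem zero_mem_interior_integrableExpSet_wishartScore {m : ℝ} (hm : 1 < m)
    {S A : Matrix (Fin 2) (Fin 2) ℝ} (hS : S.PosDef) (hA : A.IsSymm) :
    0 ∈ interior
      (ProbabilityTheory.integrableExpSet (wishartScore m S A) (wishartMeasure m S)) :=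
  mem_interior_iff_mem_nhds.2 (eventually_integrable_exp_wishartScore hm hS hA)

theorem integrable_wishartScore_sq {m : ℝ} (hm : 1 < m) {S A : Matrix (Fin 2) (Fin 2) ℝ}
    (hS : S.PosDef) (hA : A.IsSymm) :
    Integrable (fun v ↦ wishartScore m S A v ^ 2) (wishartMeasure m S) :=
  ProbabilityTheory.integrable_pow_of_mem_interior_integrableExpSet
    (zero_mem_interior_integrableExpSet_wishartScore hm hS hA) 2

theorem integral_wishartScore_sq {m : ℝ} (hm : 1 < m) {S A : Matrix (Fin 2) (Fin 2) ℝ}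
    (hS : S.PosDef) (hA : A.IsSymm) :
    ∫ v, wishartScore m S A v ^ 2 ∂wishartMeasure m S =
      m / 2 * (S⁻¹ * A * S⁻¹ * A).trace := by
  have h := ProbabilityTheory.iteratedDeriv_mgf_zero
    (zero_mem_interior_integrableExpSet_wishartScore hm hS hA) 2
  rw [iteratedDeriv_succ, iteratedDeriv_one, (mgf_wishartScore hm hS hA).deriv.deriv_eq,
    deriv_deriv_exp_mul_rpow] at h
  refine h.symm.trans ?_
  rw [Matrix.mul_assoc (S⁻¹ * A)]
  simp only [Matrix.trace_fin_two, Matrix.det_fin_two, Matrix.mul_apply (M := S⁻¹ * A),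
    Fin.sum_univ_two]
  ring

theorem integral_wishartScore_mul {m : ℝ} (hm : 1 < m) {S A B : Matrix (Fin 2) (Fin 2) ℝ}
    (hS : S.PosDef) (hA : A.IsSymm) (hB : B.IsSymm) :
    ∫ v, wishartScore m S A v * wishartScore m S B v ∂wishartMeasure m S =
      m / 2 * (S⁻¹ * A * S⁻¹ * B).trace := by
  have hpol : ∀ v, wishartScore m S A v * wishartScore m S B v =
      (wishartScore m S (A + B) v ^ 2 - wishartScore m S (A - B) v ^ 2) / 4 := fun v ↦ by
    rw [wishartScore_add, wishartScore_sub]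
    ring
  simp_rw [hpol]
  rw [integral_div, integral_sub (integrable_wishartScore_sq hm hS (hA.add hB))
    (integrable_wishartScore_sq hm hS (hA.sub hB)),
    integral_wishartScore_sq hm hS (hA.add hB), integral_wishartScore_sq hm hS (hA.sub hB)]
  have hcomm : (S⁻¹ * B * S⁻¹ * A).trace = (S⁻¹ * A * S⁻¹ * B).trace := by
    rw [Matrix.mul_assoc (S⁻¹ * B), Matrix.trace_mul_comm, ← Matrix.mul_assoc]
  simp only [Matrix.mul_add, Matrix.add_mul, Matrix.mul_sub, Matrix.sub_mul, Matrix.trace_add,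
    Matrix.trace_sub, hcomm]
  ring

theorem fisher_wishart {m : ℝ} (hm : 1 < m) {S A B : Matrix (Fin 2) (Fin 2) ℝ}
    (hS : S.PosDef) (hA : A.IsSymm) (hB : B.IsSymm) :
    ∫ v : Fin 3 → ℝ,
        deriv (fun t => Real.log (wishartDens m (S + t • A) v)) (0 : ℝ) *
        deriv (fun t => Real.log (wishartDens m (S + t • B) v)) (0 : ℝ) * wishartDens m S v =
      m / 2 * (S⁻¹ * A * S⁻¹ * B).trace := by
  rw [← integral_wishartScore_mul hm hS hA hB, integral_wishartMeasure hm hS]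
  refine integral_congr_ae (.of_forall fun v ↦ ?_)
  by_cases hv : (symOf v).PosDef
  · simp only [(hasDerivAt_log_wishartDens hm hS.det_pos _ hv).deriv]
  · simp [wishartDens, hv]

theorem sigmaP_eq (x : Fin 3 → ℝ) :
    sigmaP x = !![Real.exp (x 0) * (Real.exp (x 1) * Real.cos (x 2 / 2) ^ 2 +
          Real.exp (-x 1) * Real.sin (x 2 / 2) ^ 2),
        Real.exp (x 0) * (Real.exp (x 1) * (Real.cos (x 2 / 2) * Real.sin (x 2 / 2)) +
          Real.exp (-x 1) * -(Real.cos (x 2 / 2) * Real.sin (x 2 / 2)));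
      Real.exp (x 0) * (Real.exp (x 1) * (Real.cos (x 2 / 2) * Real.sin (x 2 / 2)) +
          Real.exp (-x 1) * -(Real.cos (x 2 / 2) * Real.sin (x 2 / 2))),
        Real.exp (x 0) * (Real.exp (x 1) * Real.sin (x 2 / 2) ^ 2 +
          Real.exp (-x 1) * Real.cos (x 2 / 2) ^ 2)] := by
  ext i j
  fin_cases i <;> fin_cases j <;>
    simp only [sigmaP, rotM, Matrix.smul_apply, Matrix.mul_apply, Fin.sum_univ_two,
      Matrix.diagonal_apply, Matrix.transpose_apply, Matrix.of_apply, Matrix.cons_val,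
      Matrix.cons_val', smul_eq_mul] <;>
    simp <;> ring

theorem pderiv'_exp_mul {u w : ℝ → ℝ} {u' w' : ℝ} {x : Fin 3 → ℝ} (hu : HasDerivAt u u' (x 2))
    (hw : HasDerivAt w w' (x 2)) (a : Fin 3) :
    pderiv' a (fun y ↦ Real.exp (y 0) * (Real.exp (y 1) * u (y 2) + Real.exp (-y 1) * w (y 2))) x =
      ![Real.exp (x 0) * (Real.exp (x 1) * u (x 2) + Real.exp (-x 1) * w (x 2)),
        Real.exp (x 0) * (Real.exp (x 1) * u (x 2) - Real.exp (-x 1) * w (x 2)),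
        Real.exp (x 0) * (Real.exp (x 1) * u' + Real.exp (-x 1) * w')] a := by
  have h : ∀ i, HasFDerivAt (fun y : Fin 3 → ℝ ↦ y i) (ContinuousLinearMap.proj (R := ℝ) i) x :=
    fun i ↦ hasFDerivAt_apply i x
  have hf := (h 0).exp.fun_mul (((h 1).exp.fun_mul (hu.comp_hasFDerivAt x (h 2))).fun_add
    ((h 1).fun_neg.exp.fun_mul (hw.comp_hasFDerivAt x (h 2))))
  refine (congrArg (· (Pi.single a 1)) hf.fderiv).trans ?_
  fin_cases a <;> simp <;> ring

theorem dSigma_eq (a : Fin 3) (x : Fin 3 → ℝ) :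
    dSigma a x = ![sigmaP x,
      Real.exp (x 0) • !![Real.exp (x 1) * Real.cos (x 2 / 2) ^ 2 -
            Real.exp (-x 1) * Real.sin (x 2 / 2) ^ 2,
          (Real.exp (x 1) + Real.exp (-x 1)) * (Real.cos (x 2 / 2) * Real.sin (x 2 / 2));
        (Real.exp (x 1) + Real.exp (-x 1)) * (Real.cos (x 2 / 2) * Real.sin (x 2 / 2)),
          Real.exp (x 1) * Real.sin (x 2 / 2) ^ 2 - Real.exp (-x 1) * Real.cos (x 2 / 2) ^ 2],
      (Real.exp (x 0) * (Real.exp (x 1) - Real.exp (-x 1))) •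
        !![-(Real.cos (x 2 / 2) * Real.sin (x 2 / 2)),
          (Real.cos (x 2 / 2) ^ 2 - Real.sin (x 2 / 2) ^ 2) / 2;
        (Real.cos (x 2 / 2) ^ 2 - Real.sin (x 2 / 2) ^ 2) / 2,
          Real.cos (x 2 / 2) * Real.sin (x 2 / 2)]] a := by
  have hhalf : HasDerivAt (fun t : ℝ ↦ t / 2) (1 / 2) (x 2) := (hasDerivAt_id _).div_const 2
  have hc := hhalf.cos
  have hs := hhalf.sin
  have hcc := pderiv'_exp_mul (hc.fun_pow 2) (hs.fun_pow 2) a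
  have hss := pderiv'_exp_mul (hs.fun_pow 2) (hc.fun_pow 2) a
  have hcs := pderiv'_exp_mul (hc.fun_mul hs) (hc.fun_mul hs).fun_neg a
  ext i j
  simp only [dSigma, sigmaP_eq]
  fin_cases i <;> fin_cases j
  · refine hcc.trans ?_
    fin_cases a <;> simp
    ring
  · refine hcs.trans ?_
    fin_cases a <;> simp <;> ring
  · refine hcs.trans ?_
    fin_cases a <;> simp <;> ring
  · refine hss.trans ?_
    fin_cases a <;> simp
    ring

theorem sigmaP_inv (x : Fin 3 → ℝ) :
    (sigmaP x)⁻¹ = Real.exp (-x 0) • !![Real.exp (x 1) * Real.sin (x 2 / 2) ^ 2 +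
          Real.exp (-x 1) * Real.cos (x 2 / 2) ^ 2,
        -((Real.exp (x 1) - Real.exp (-x 1)) * (Real.cos (x 2 / 2) * Real.sin (x 2 / 2)));
      -((Real.exp (x 1) - Real.exp (-x 1)) * (Real.cos (x 2 / 2) * Real.sin (x 2 / 2))),
        Real.exp (x 1) * Real.cos (x 2 / 2) ^ 2 + Real.exp (-x 1) * Real.sin (x 2 / 2) ^ 2] := by
  have hc := Real.cos_sq' (x 2 / 2)
  refine Matrix.inv_eq_right_inv ?_
  rw [sigmaP_eq, Real.exp_neg, Real.exp_neg]
  ext i j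
  fin_cases i <;> fin_cases j <;>
    simp only [Matrix.smul_apply, Matrix.mul_apply, Fin.sum_univ_two, Matrix.of_apply,
      Matrix.cons_val, Matrix.cons_val', smul_eq_mul] <;>
    simp <;> field_simp <;> grind

theorem pullback_metric (m : ℝ) (x : Fin 3 → ℝ) (a b : Fin 3) :
    m / 2 * ((sigmaP x)⁻¹ * dSigma a x * (sigmaP x)⁻¹ * dSigma b x).trace =
      Matrix.diagonal ![m, m, m * Real.sinh (x 1) ^ 2] a b := by
  have hc := Real.cos_sq' (x 2 / 2)
  rw [dSigma_eq, dSigma_eq, sigmaP_inv, sigmaP_eq, Real.sinh_eq]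
  simp only [Real.exp_neg]
  fin_cases a <;> fin_cases b <;>
    simp only [Matrix.trace_fin_two, Matrix.smul_apply, Matrix.mul_apply, Fin.sum_univ_two,
      Matrix.of_apply, Matrix.cons_val, Matrix.cons_val', smul_eq_mul, Matrix.diagonal_apply] <;>
    simp <;> field_simp <;> grind

/-- the Fisher metric of the 2×2 Wishart model `W₂(m, Σ)` is
`⟨A,B⟩_Σ = (m/2) tr(Σ⁻¹ A Σ⁻¹ B)` for symmetric tangent directions `A`, `B`, and in the
parameterization `Σ = e^λ R_{θ/2} diag(e^ρ, e^{−ρ}) R_{θ/2}^T` this metric is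
`m(dλ² + dρ² + sinh²ρ dθ²)`. -/
theorem stmt14 (m : ℝ) (hm : 2 ≤ m) :
    (∀ (S A B : Matrix (Fin 2) (Fin 2) ℝ), S.PosDef → A.IsSymm → B.IsSymm →
      ∫ v : Fin 3 → ℝ,
          deriv (fun t => Real.log (wishartDens m (S + t • A) v)) (0:ℝ) *
          deriv (fun t => Real.log (wishartDens m (S + t • B) v)) (0:ℝ) * wishartDens m S v
        = (m / 2) * (S⁻¹ * A * S⁻¹ * B).trace) ∧
    (∀ x : Fin 3 → ℝ, 0 < x 1 → ∀ a b : Fin 3,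
      (m / 2) * ((sigmaP x)⁻¹ * dSigma a x * (sigmaP x)⁻¹ * dSigma b x).trace
        = Matrix.diagonal ![m, m, m * Real.sinh (x 1) ^ 2] a b) := by
  exact ⟨fun _ _ _ hS hA hB ↦ fisher_wishart (by linarith) hS hA hB,
    fun x _ a b ↦ pullback_metric m x a b⟩
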